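/- Let α and β be Forward Regular XPath path formulas in which negation is restricted to labels only. Then α is contained in β as a binary query (α ⊆² β) if and only if α is contained in β as a unary query (α ⊆¹ β). This holds both over single-labeled trees and over multi-labeled trees. -/

import Mathlib

/- Trees over a label alphabet -/
structure RTree (A : Type) where
  Node : Type
  E : Node → Node → Prop
  root : Node
  label : Node → Set A

namespace RTree
variable {A : Type}

/-- Tree axioms not requiring finiteness of the node set: finite label sets,
    connectedness from the root, unique parents, acyclicity. -/
def IsPreTree (T : RTree A) : Prop :=
  (∀ n, (T.label n).Finite) ∧
  (∀ n, Relation.ReflTransGen T.E T.root n) ∧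
  (∀ n m m', T.E m n → T.E m' n → m = m') ∧
  (∀ n, ¬ Relation.TransGen T.E n n)

/-- A (finite, rooted, unranked) tree. -/
def IsTree (T : RTree A) : Prop := T.IsPreTree ∧ Finite T.Node

/-- Single-labeled (XML) trees: every node carries exactly one label. -/
def SingleLabeled (T : RTree A) : Prop := ∀ n, ∃ p, T.label n = {p}

end RTree

/- Forward Regular XPath: node formulas and path formulas -/
mutual
inductive RNF (A : Type) : Type where
  | lab : A → RNF A
  | top : RNF A
  | neg : RNF A → RNF A
  | or : RNF A → RNF A → RNF A
  | and : RNF A → RNF A → RNF A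
  | dia : RPF A → RNF A → RNF A
inductive RPF (A : Type) : Type where
  | child : RPF A
  | test : RNF A → RPF A
  | comp : RPF A → RPF A → RPF A
  | union : RPF A → RPF A → RPF A
  | star : RPF A → RPF A
end

variable {A : Type}

mutual
/-- Satisfaction of node formulas: the set of nodes where the formula holds. -/
def RNF.sat (T : RTree A) : RNF A → Set T.Node
  | .lab p => {n | p ∈ T.label n}
  | .top => Set.univ
  | .neg φ => {n | ¬ (n ∈ RNF.sat T φ)}
  | .or φ ψ => {n | n ∈ RNF.sat T φ ∨ n ∈ RNF.sat T ψ}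
  | .and φ ψ => {n | n ∈ RNF.sat T φ ∧ n ∈ RNF.sat T ψ}
  | .dia α φ => {n | ∃ m, RPF.sem T α n m ∧ m ∈ RNF.sat T φ}
/-- Semantics of path formulas: a binary relation on nodes. -/
def RPF.sem (T : RTree A) : RPF A → T.Node → T.Node → Prop
  | .child => T.E
  | .test φ => fun n m => n = m ∧ n ∈ RNF.sat T φ
  | .comp α β => fun n m => ∃ k, RPF.sem T α n k ∧ RPF.sem T β k m
  | .union α β => fun n m => RPF.sem T α n m ∨ RPF.sem T β n m
  | .star α => Relation.ReflTransGen (RPF.sem T α)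
end

mutual
/-- Negation is restricted to labels only. -/
def RNF.negOK : RNF A → Prop
  | .lab _ => True
  | .top => True
  | .neg φ => ∃ p, φ = RNF.lab p
  | .or φ ψ => RNF.negOK φ ∧ RNF.negOK ψ
  | .and φ ψ => RNF.negOK φ ∧ RNF.negOK ψ
  | .dia α φ => RPF.negOK α ∧ RNF.negOK φ
def RPF.negOK : RPF A → Prop
  | .child => True
  | .test φ => RNF.negOK φ
  | .comp α β => RPF.negOK α ∧ RPF.negOK β
  | .union α β => RPF.negOK α ∧ RPF.negOK β
  | .star α => RPF.negOK α
end

/-- Containment as a binary query, over the class `C` of trees. -/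
def cont2On (C : RTree A → Prop) (α β : RPF A) : Prop :=
  ∀ T : RTree A, C T → ∀ n m : T.Node, RPF.sem T α n m → RPF.sem T β n m

/-- Containment as a unary query, over the class `C` of trees. -/
def cont1On (C : RTree A → Prop) (α β : RPF A) : Prop :=
  ∀ T : RTree A, C T → ∀ n : T.Node, RPF.sem T α T.root n → RPF.sem T β T.root n

theorem RPF.sem_reach (T : RTree A) : (α : RPF A) → ∀ n m, RPF.sem T α n m →
    Relation.ReflTransGen T.E n m
  | .child, n, m, h => by
      simp only [RPF.sem] at h
      exact .single h
  | .test φ, n, m, h => by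
      simp only [RPF.sem] at h
      rw [h.1]
  | .comp α β, n, m, h => by
      simp only [RPF.sem] at h
      obtain ⟨k, h1, h2⟩ := h
      exact (RPF.sem_reach T α n k h1).trans (RPF.sem_reach T β k m h2)
  | .union α β, n, m, h => by
      simp only [RPF.sem] at h
      exact h.elim (RPF.sem_reach T α n m) (RPF.sem_reach T β n m)
  | .star α, n, m, h => by
      simp only [RPF.sem] at h
      induction h with
      | refl => exact .refl
      | tail _ h2 ih => exact ih.trans (RPF.sem_reach T α _ _ h2)

/-- The subtree rooted at a node. -/
def RTree.sub (T : RTree A) (r : T.Node) : RTree A where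
  Node := {m : T.Node // Relation.ReflTransGen T.E r m}
  E x y := T.E x.1 y.1
  root := ⟨r, .refl⟩
  label x := T.label x.1

mutual
theorem RNF.sat_sub (T : RTree A) (r : T.Node) : (φ : RNF A) → ∀ x : (T.sub r).Node,
    x ∈ RNF.sat (T.sub r) φ ↔ x.1 ∈ RNF.sat T φ
  | .lab p, x => by simp only [RNF.sat]; rfl
  | .top, x => by simp [RNF.sat]
  | .neg φ, x => by
      simp only [RNF.sat, Set.mem_ofPred_eq]; exact not_congr (RNF.sat_sub T r φ x)
  | .or φ ψ, x => by
      simp only [RNF.sat, Set.mem_ofPred_eq]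
      exact or_congr (RNF.sat_sub T r φ x) (RNF.sat_sub T r ψ x)
  | .and φ ψ, x => by
      simp only [RNF.sat, Set.mem_ofPred_eq]
      exact and_congr (RNF.sat_sub T r φ x) (RNF.sat_sub T r ψ x)
  | .dia α φ, x => by
      simp only [RNF.sat, Set.mem_ofPred_eq]
      constructor
      · rintro ⟨m, h1, h2⟩
        exact ⟨m.1, (RPF.sem_sub T r α x m).1 h1, (RNF.sat_sub T r φ m).1 h2⟩
      · rintro ⟨m, h1, h2⟩
        have hm := x.2.trans (RPF.sem_reach T α _ _ h1)
        exact ⟨⟨m, hm⟩, (RPF.sem_sub T r α x ⟨m, hm⟩).2 h1, (RNF.sat_sub T r φ ⟨m, hm⟩).2 h2⟩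
theorem RPF.sem_sub (T : RTree A) (r : T.Node) : (α : RPF A) → ∀ x y : (T.sub r).Node,
    RPF.sem (T.sub r) α x y ↔ RPF.sem T α x.1 y.1
  | .child, x, y => by simp only [RPF.sem]; rfl
  | .test φ, x, y => by
      simp only [RPF.sem]
      exact and_congr Subtype.ext_iff (RNF.sat_sub T r φ x)
  | .comp α β, x, y => by
      simp only [RPF.sem]
      constructor
      · rintro ⟨m, h1, h2⟩
        exact ⟨m.1, (RPF.sem_sub T r α x m).1 h1, (RPF.sem_sub T r β m y).1 h2⟩
      · rintro ⟨m, h1, h2⟩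
        have hm := x.2.trans (RPF.sem_reach T α _ _ h1)
        exact ⟨⟨m, hm⟩, (RPF.sem_sub T r α x ⟨m, hm⟩).2 h1, (RPF.sem_sub T r β ⟨m, hm⟩ y).2 h2⟩
  | .union α β, x, y => by
      simp only [RPF.sem]
      exact or_congr (RPF.sem_sub T r α x y) (RPF.sem_sub T r β x y)
  | .star α, x, y => by
      simp only [RPF.sem]
      constructor
      · intro h
        induction h with
        | refl => exact .refl
        | tail _ h2 ih => exact ih.tail ((RPF.sem_sub T r α _ _).1 h2)
      · intro h
        obtain ⟨y, hy⟩ := y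
        change Relation.ReflTransGen (RPF.sem T α) x.1 y at h
        induction h with
        | refl => exact .refl
        | @tail b c h1 h2 ih =>
          have hb : Relation.ReflTransGen T.E r b :=
            x.2.trans (RPF.sem_reach T (.star α) _ _ (by simpa only [RPF.sem] using h1))
          exact (ih hb).tail ((RPF.sem_sub T r α ⟨b, hb⟩ ⟨c, hy⟩).2 h2)
end

theorem RTree.sub_isTree (T : RTree A) (r : T.Node) (h : T.IsTree) : (T.sub r).IsTree := by
  obtain ⟨⟨h1, h2, h3, h4⟩, h5⟩ := h
  refine ⟨⟨fun n => h1 n.1, ?_, fun n m m' a b => Subtype.ext (h3 _ _ _ a b), ?_⟩, ?_⟩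
  · rintro ⟨n, hn⟩
    induction hn with
    | refl => exact .refl
    | tail a b ih => exact Relation.ReflTransGen.tail ih b
  · intro n hn
    exact h4 n.1 (Relation.TransGen.lift (r := (T.sub r).E) (p := T.E) Subtype.val (fun _ _ h => h) _ _ hn)
  · exact Subtype.finite

theorem cont_iff_of_sub (C : RTree A → Prop) (hC : ∀ T r, C T → C (T.sub r)) (α β : RPF A) :
    cont2On C α β ↔ cont1On C α β := by
  constructor
  · exact fun h T hT n => h T hT _ n
  · intro h T hT n m hα
    have hm := RPF.sem_reach T α _ _ hα
    exact (RPF.sem_sub T n β ⟨n, .refl⟩ ⟨m, hm⟩).1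
      (h (T.sub n) (hC T n hT) ⟨m, hm⟩ ((RPF.sem_sub T n α ⟨n, .refl⟩ ⟨m, hm⟩).2 hα))

/-- for Forward Regular XPath path formulas in which negation is
restricted to labels only, containment as a binary query coincides with
containment as a unary query, both over single-labeled and over multi-labeled
trees. -/
theorem rxp_cont2_iff_cont1 [Infinite A] (α β : RPF A)
    (hα : RPF.negOK α) (hβ : RPF.negOK β) :
    (cont2On (fun T : RTree A => T.IsTree ∧ T.SingleLabeled) α β ↔
      cont1On (fun T : RTree A => T.IsTree ∧ T.SingleLabeled) α β) ∧
    (cont2On (fun T : RTree A => T.IsTree) α β ↔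
      cont1On (fun T : RTree A => T.IsTree) α β) := by
  exact ⟨cont_iff_of_sub _ (fun T r h => ⟨T.sub_isTree r h.1, fun n => h.2 n.1⟩) α β,
    cont_iff_of_sub _ (fun T r h => T.sub_isTree r h) α β⟩
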